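/- Let (G, D, ⋄, I) be a partial semigroup with identity and S a complete idempotent semiring. The star operation on G → S satisfies the Kleene algebra axioms with respect to the pointwise order: for all λ, μ, ν : G → S, (1) e ⊔ (λ ⋆ λ*) ≤ λ*; (2) e ⊔ (λ* ⋆ λ) ≤ λ*; (3) if μ ⊔ (λ ⋆ ν) ≤ ν then λ* ⋆ μ ≤ ν; (4) if μ ⊔ (ν ⋆ λ) ≤ ν then μ ⋆ λ* ≤ ν. -/

import Mathlib

/-- A partial semigroup with identity: a binary domain relation `D`,
a partial operation `op`, and a set `I` of identity elements,
satisfying axioms (i)-(vi). -/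
structure PartialSemigroupWithIdentity (G : Type*) where
  D : G → G → Prop
  op : G → G → G
  I : Set G
  ax_i : ∀ x y z, (D x y ∧ D (op x y) z) ↔ (D y z ∧ D x (op y z))
  ax_ii : ∀ x y z, D x y → D (op x y) z → op (op x y) z = op x (op y z)
  ax_iii : ∀ x, ∃ y ∈ I, D x y
  ax_iv : ∀ x, ∃ y ∈ I, D y x
  ax_v : ∀ x y, D x y → y ∈ I → x = op x y
  ax_vi : ∀ x y, D y x → y ∈ I → x = op y x

variable {G S : Type*}

/-- Convolution of `S`-valued functions on `G`:
`(f ⋆ g)(x) = ⨆ { f y · g z | D y z and y ⋄ z = x }`. -/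
noncomputable def conv [CompleteLattice S] [Monoid S]
    (P : PartialSemigroupWithIdentity G) (f g : G → S) : G → S :=
  fun x => ⨆ p : {p : G × G // P.D p.1 p.2 ∧ P.op p.1 p.2 = x}, f p.val.1 * g p.val.2

open Classical in
/-- The convolution unit: `1` on `I` and `⊥` elsewhere. -/
noncomputable def cunit [CompleteLattice S] [Monoid S]
    (P : PartialSemigroupWithIdentity G) : G → S :=
  fun x => if x ∈ P.I then 1 else ⊥

/-- Convolution powers: `λ⁰ = cunit P`, `λ^(n+1) = λⁿ ⋆ λ`. -/
noncomputable def cpow [CompleteLattice S] [Monoid S]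
    (P : PartialSemigroupWithIdentity G) (f : G → S) : ℕ → (G → S)
  | 0 => cunit P
  | n + 1 => conv P (cpow P f n) f

/-- The Kleene star of a function: the pointwise supremum of its powers. -/
noncomputable def cstar [CompleteLattice S] [Monoid S]
    (P : PartialSemigroupWithIdentity G) (f : G → S) : G → S :=
  ⨆ n : ℕ, cpow P f n

section Convolution

variable [CompleteLattice S] [Monoid S] (P : PartialSemigroupWithIdentity G)

theorem conv_le_iff {f g h : G → S} :
    conv P f g ≤ h ↔ ∀ y z, P.D y z → f y * g z ≤ h (P.op y z) := by
  constructor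
  · intro H y z hD
    exact le_trans (le_iSup (fun p : {p : G × G // P.D p.1 p.2 ∧ P.op p.1 p.2 = P.op y z} =>
      f p.val.1 * g p.val.2) ⟨(y, z), hD, rfl⟩) (H (P.op y z))
  · intro H x
    refine iSup_le ?_
    rintro ⟨⟨y, z⟩, hD, rfl⟩
    exact H y z hD

theorem mul_le_conv (f g : G → S) {y z : G} (hD : P.D y z) :
    f y * g z ≤ conv P f g (P.op y z) :=
  (conv_le_iff P).1 le_rfl y z hD

theorem cunit_le_cstar (f : G → S) : cunit P ≤ cstar P f :=
  le_iSup (cpow P f) 0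

variable [IsQuantale S]

theorem conv_mono {f f' g g' : G → S} (hf : f ≤ f') (hg : g ≤ g') :
    conv P f g ≤ conv P f' g' :=
  (conv_le_iff P).2 fun y z hD => (mul_le_mul' (hf y) (hg z)).trans (mul_le_conv P f' g' hD)

theorem conv_iSup_le {ι : Type*} {f : G → S} {g : ι → G → S} {h : G → S}
    (H : ∀ i, conv P f (g i) ≤ h) : conv P f (⨆ i, g i) ≤ h := by
  refine (conv_le_iff P).2 fun y z hD => ?_
  rw [iSup_apply, Quantale.mul_iSup_distrib]
  exact iSup_le fun i => (conv_le_iff P).1 (H i) y z hD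

theorem iSup_conv_le {ι : Type*} {f : ι → G → S} {g h : G → S}
    (H : ∀ i, conv P (f i) g ≤ h) : conv P (⨆ i, f i) g ≤ h := by
  refine (conv_le_iff P).2 fun y z hD => ?_
  rw [iSup_apply, Quantale.iSup_mul_distrib]
  exact iSup_le fun i => (conv_le_iff P).1 (H i) y z hD

theorem conv_assoc (f g h : G → S) :
    conv P (conv P f g) h = conv P f (conv P g h) := by
  apply le_antisymm
  · refine (conv_le_iff P).2 fun x c hD => ?_
    unfold conv
    rw [Quantale.iSup_mul_distrib]
    refine iSup_le ?_
    rintro ⟨⟨a, b⟩, hab, rfl⟩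
    obtain ⟨hbc, habc⟩ := (P.ax_i a b c).1 ⟨hab, hD⟩
    rw [mul_assoc, P.ax_ii a b c hab hD]
    exact (mul_le_mul_right (mul_le_conv P g h hbc) (f a)).trans
      (mul_le_conv P f (conv P g h) habc)
  · refine (conv_le_iff P).2 fun a x hD => ?_
    unfold conv
    rw [Quantale.mul_iSup_distrib]
    refine iSup_le ?_
    rintro ⟨⟨b, c⟩, hbc, rfl⟩
    obtain ⟨hab, habc⟩ := (P.ax_i a b c).2 ⟨hbc, hD⟩
    rw [← mul_assoc, ← P.ax_ii a b c hab habc]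
    exact (mul_le_mul_left (mul_le_conv P f g hab) (h c)).trans
      (mul_le_conv P (conv P f g) h habc)

theorem cunit_conv (f : G → S) : conv P (cunit P) f = f := by
  apply le_antisymm
  · refine (conv_le_iff P).2 fun y z hD => ?_
    by_cases hy : y ∈ P.I
    · simp [cunit, hy, ← P.ax_vi z y hD hy]
    · simp [cunit, hy]
  · intro x
    obtain ⟨y, hy, hD⟩ := P.ax_iv x
    simpa [cunit, hy, ← P.ax_vi x y hD hy] using mul_le_conv P (cunit P) f hD

theorem conv_cunit (f : G → S) : conv P f (cunit P) = f := by
  apply le_antisymm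
  · refine (conv_le_iff P).2 fun y z hD => ?_
    by_cases hz : z ∈ P.I
    · simp [cunit, hz, ← P.ax_v y z hD hz]
    · simp [cunit, hz]
  · intro x
    obtain ⟨y, hy, hD⟩ := P.ax_iii x
    simpa [cunit, hy, ← P.ax_v x y hD hy] using mul_le_conv P f (cunit P) hD

theorem cpow_succ_eq_conv_cpow (f : G → S) (n : ℕ) :
    cpow P f (n + 1) = conv P f (cpow P f n) := by
  induction n with
  | zero => simp only [cpow, cunit_conv, conv_cunit]
  | succ n ih =>
    calc conv P (cpow P f (n + 1)) f = conv P (conv P f (cpow P f n)) f := by rw [ih]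
      _ = conv P f (cpow P f (n + 1)) := conv_assoc P f (cpow P f n) f

theorem conv_cstar_le_cstar (f : G → S) : conv P f (cstar P f) ≤ cstar P f :=
  conv_iSup_le P fun n =>
    (cpow_succ_eq_conv_cpow P f n).ge.trans (le_iSup (cpow P f) (n + 1))

theorem cstar_conv_le_cstar (f : G → S) : conv P (cstar P f) f ≤ cstar P f :=
  iSup_conv_le P fun n => le_iSup (cpow P f) (n + 1)

theorem cstar_conv_le {f g h : G → S} (hg : g ≤ h) (hf : conv P f h ≤ h) :
    conv P (cstar P f) g ≤ h := by
  refine iSup_conv_le P fun n => ?_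
  induction n with
  | zero => exact (cunit_conv P g).trans_le hg
  | succ n ih =>
    rw [cpow_succ_eq_conv_cpow, conv_assoc]
    exact (conv_mono P le_rfl ih).trans hf

theorem conv_cstar_le {f g h : G → S} (hg : g ≤ h) (hf : conv P h f ≤ h) :
    conv P g (cstar P f) ≤ h := by
  refine conv_iSup_le P fun n => ?_
  induction n with
  | zero => exact (conv_cunit P g).trans_le hg
  | succ n ih =>
    rw [cpow, ← conv_assoc]
    exact (conv_mono P ih le_rfl).trans hf

end Convolution

/-- The star operation satisfies the Kleene algebra axioms with respect to the
pointwise order. -/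
theorem stmt_9 [Nonempty G] [CompleteLattice S] [Monoid S]
    (hl : ∀ (x : S) (A : Set S), x * sSup A = ⨆ a ∈ A, x * a)
    (hr : ∀ (x : S) (A : Set S), sSup A * x = ⨆ a ∈ A, a * x)
    (P : PartialSemigroupWithIdentity G) (l μ ν : G → S) :
    cunit P ⊔ conv P l (cstar P l) ≤ cstar P l ∧
    cunit P ⊔ conv P (cstar P l) l ≤ cstar P l ∧
    (μ ⊔ conv P l ν ≤ ν → conv P (cstar P l) μ ≤ ν) ∧
    (μ ⊔ conv P ν l ≤ ν → conv P μ (cstar P l) ≤ ν) := by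
  have : IsQuantale S := ⟨hl, fun A x => hr x A⟩
  exact ⟨sup_le (cunit_le_cstar P l) (conv_cstar_le_cstar P l),
    sup_le (cunit_le_cstar P l) (cstar_conv_le_cstar P l),
    fun h => cstar_conv_le P (sup_le_iff.1 h).1 (sup_le_iff.1 h).2,
    fun h => conv_cstar_le P (sup_le_iff.1 h).1 (sup_le_iff.1 h).2⟩
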